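/- There is an absolute constant k ∈ ℕ such that the following holds. Let G = (S₀, S₁, E) be a finite weighted game with maximal absolute weight W, s_init an initial state, and t = t₁/t₂ ∈ ℚ a threshold; set U = 2^{k·(t + W·(8 t₁ t₂ (t+1)³ |S|² + 1) + |S| + |E|·W + |S|·(⌈t⌉+1))}. Then P₀ has a winning strategy in G from s_init for the objective AEL(t) = EGL ∩ AE(t) if, and only if, P₀ has a winning strategy in G from s_init for the objective AELU(t, U) = EGLU(U) ∩ AE(t). -/

import Mathlib

namespace AvgEnergy

/-- An integer-weighted edge over a state space `α`. -/
abbrev WEdge (α : Type*) : Type _ := α × ℤ × α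

/-- A finite turn-based weighted game `G = (S₀, S₁, E)`:
`S₀` and `S₁` are disjoint sets of states covering `S`, edges carry integer
weights bounded in absolute value by `W`, and every state has an outgoing edge. -/
structure Game (S : Type*) where
  S0 : Set S
  S1 : Set S
  E : Set (WEdge S)
  W : ℕ
  disj : Disjoint S0 S1
  cover : S0 ∪ S1 = Set.univ
  wbound : ∀ e ∈ E, -(W : ℤ) ≤ e.2.1 ∧ e.2.1 ≤ (W : ℤ)
  total : ∀ s : S, ∃ w s', (s, w, s') ∈ E

variable {α : Type*}

/-- A play from `s`: an infinite sequence of consecutive edges of `E` starting at `s`. -/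
def IsPlay (E : Set (WEdge α)) (s : α) (π : ℕ → WEdge α) : Prop :=
  (∀ i, π i ∈ E) ∧ (π 0).1 = s ∧ ∀ i, (π i).2.2 = (π (i + 1)).1

/-- Energy level of the length-`n` prefix of `π`. -/
def EL (π : ℕ → WEdge α) (n : ℕ) : ℤ :=
  ∑ i ∈ Finset.range n, (π i).2.1

/-- Mean-payoff of the length-`n` prefix of `π`. -/
def MP (π : ℕ → WEdge α) (n : ℕ) : ℚ := (EL π n : ℚ) / n

/-- Average-energy of the length-`n` prefix of `π`. -/
def AE (π : ℕ → WEdge α) (n : ℕ) : ℚ :=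
  (∑ i ∈ Finset.range n, (EL π (i + 1) : ℚ)) / n

/-- `limsup_{n → ∞} f n ≤ t` (ε-characterization, valid in `ℚ`). -/
def LimsupLE (f : ℕ → ℚ) (t : ℚ) : Prop :=
  ∀ ε : ℚ, 0 < ε → ∃ N, ∀ n ≥ N, f n ≤ t + ε

/-- The state reached after following the finite prefix `ρ` from `s`. -/
def EndSt (s : α) (ρ : List (WEdge α)) : α :=
  (ρ.getLast?.map (fun e => e.2.2)).getD s

/-- `ρ` is a finite play prefix from `s` in the graph with edge set `E`. -/
def IsPrefixFrom (E : Set (WEdge α)) (s : α) (ρ : List (WEdge α)) : Prop :=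
  (∀ e ∈ ρ, e ∈ E) ∧ List.Chain' (fun e f => e.2.2 = f.1) ρ ∧
    ∀ e, ρ.head? = some e → e.1 = s

/-- A strategy (of the player owning the states in `S0`) from `s`: it assigns to every
play prefix from `s` ending in a state of `S0` a valid outgoing edge. -/
def IsStrategy (E : Set (WEdge α)) (S0 : Set α) (s : α)
    (σ : List (WEdge α) → WEdge α) : Prop :=
  ∀ ρ, IsPrefixFrom E s ρ → EndSt s ρ ∈ S0 → σ ρ ∈ E ∧ (σ ρ).1 = EndSt s ρ

/-- The length-`n` prefix of a play, as a list of edges. -/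
def Pref (π : ℕ → WEdge α) (n : ℕ) : List (WEdge α) :=
  List.ofFn (fun i : Fin n => π i)

/-- `π` is an outcome of the strategy `σ` (for the player owning `S0`) from `s`. -/
def IsOutcome (E : Set (WEdge α)) (S0 : Set α) (s : α)
    (σ : List (WEdge α) → WEdge α) (π : ℕ → WEdge α) : Prop :=
  IsPlay E s π ∧ ∀ n, EndSt s (Pref π n) ∈ S0 → π n = σ (Pref π n)

/-- Configurations of the expanded game: `⊥` is `none`. -/
abbrev Conf (S : Type*) := Option (S × ℕ)

/-- Edges of the expanded infinite-state weighted game `G'`: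
`((s,c), c', (s',c'))` whenever `(s,w,s') ∈ E` and `c' = c + w ≥ 0`;
`((s,c), ⌈t⌉+1, ⊥)` whenever some `(s,w,s') ∈ E` has `c + w < 0`; and
`(⊥, ⌈t⌉+1, ⊥)`. -/
def ExpE {S : Type*} (G : Game S) (t : ℚ) : Set (WEdge (Conf S)) :=
  {e | (∃ (s : S) (c : ℕ) (w : ℤ) (s' : S) (c' : ℕ), (s, w, s') ∈ G.E ∧ (c : ℤ) + w = (c' : ℤ) ∧
          e = (some (s, c), (c' : ℤ), some (s', c'))) ∨
       (∃ (s : S) (c : ℕ) (w : ℤ) (s' : S), (s, w, s') ∈ G.E ∧ (c : ℤ) + w < 0 ∧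
          e = (some (s, c), ⌈t⌉ + 1, (none : Conf S))) ∨
       e = ((none : Conf S), ⌈t⌉ + 1, (none : Conf S))}

/-- The configurations of the expanded game belonging to player `P₀`. -/
def ExpS0 {S : Type*} (G : Game S) : Set (Conf S) :=
  {γ | ∃ s c, s ∈ G.S0 ∧ γ = some (s, c)}

/-- The state (configuration) visited at position `n` along a play from `s`:
`γ₀ = s` and `γ_{n+1}` is the target of the `(n+1)`-st edge. -/
def StAt (s : α) (π : ℕ → WEdge α) : ℕ → α
  | 0 => s
  | n + 1 => (π n).2.2

end AvgEnergy

namespace AvgEnergy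

/-- A turn-based arena with finite branching and vertex costs.
The vertices of `own` belong to the protagonist. -/
structure Arena (V : Type*) where
  step : V → V → Prop
  own : Set V
  cost : V → ℤ
  finite_step : ∀ v, {u | step v u}.Finite

namespace Arena

variable {V : Type*} (A : Arena V)

/-- The protagonist can force the next vertex to satisfy `Q`. -/
def Ctrl (Q : V → Prop) (v : V) : Prop :=
  (v ∈ A.own → ∃ u, A.step v u ∧ Q u) ∧ (v ∉ A.own → ∀ u, A.step v u → Q u)

/-- The antagonist can force the next vertex to satisfy `Q`. -/
def OppCtrl (Q : V → Prop) (v : V) : Prop :=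
  (v ∈ A.own → ∀ u, A.step v u → Q u) ∧ (v ∉ A.own → ∃ u, A.step v u ∧ Q u)

variable {A}

lemma Ctrl.mono {Q Q' : V → Prop} {v : V} (h : A.Ctrl Q v)
    (hQ : ∀ u, A.step v u → Q u → Q' u) : A.Ctrl Q' v := by
  refine ⟨fun hv => ?_, fun hv u hu => hQ u hu (h.2 hv u hu)⟩
  obtain ⟨u, hu, hq⟩ := h.1 hv
  exact ⟨u, hu, hQ u hu hq⟩

lemma OppCtrl.mono {Q Q' : V → Prop} {v : V} (h : A.OppCtrl Q v)
    (hQ : ∀ u, A.step v u → Q u → Q' u) : A.OppCtrl Q' v := by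
  refine ⟨fun hv u hu => hQ u hu (h.1 hv u hu), fun hv => ?_⟩
  obtain ⟨u, hu, hq⟩ := h.2 hv
  exact ⟨u, hu, hQ u hu hq⟩

lemma oppCtrl_of_not_ctrl {Q : V → Prop} {v : V} (h : ¬ A.Ctrl Q v) :
    A.OppCtrl (fun u => ¬ Q u) v := by
  refine ⟨fun hv u hu hq => h ⟨fun _ => ⟨u, hu, hq⟩, fun hv' => absurd hv hv'⟩, fun hv => ?_⟩
  by_contra! hc
  exact h ⟨fun hv' => absurd hv' hv, fun _ => hc⟩

/-- On a finite set, a family of upward closed properties of integers holds uniformly. -/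
lemma exists_uniform_bound {s : Set V} (hs : s.Finite) {P : V → ℤ → Prop}
    (mono : ∀ v b b', b ≤ b' → P v b → P v b') (h : ∀ v ∈ s, ∃ b, P v b) :
    ∃ b, ∀ v ∈ s, P v b := by
  choose! f hf using h
  obtain ⟨b, hb⟩ := (hs.image f).bddAbove
  exact ⟨b, fun v hv => mono v _ _ (hb ⟨v, hv, rfl⟩) (hf v hv)⟩

lemma ctrl_forall_of_antitone {Q : ℕ → V → Prop} (anti : ∀ m n, m ≤ n → ∀ u, Q n u → Q m u)
    {v : V} (h : ∀ n, A.Ctrl (Q n) v) : A.Ctrl (fun u => ∀ n, Q n u) v := by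
  refine ⟨fun hv => ?_, fun hv u hu n => (h n).2 hv u hu⟩
  by_contra! hc
  obtain ⟨b, hb⟩ := exists_uniform_bound (A.finite_step v) (P := fun u b => ¬ Q b.toNat u)
    (fun u b b' hbb hn hq => hn (anti _ _ (Int.toNat_le_toNat hbb) u hq))
    (fun u hu => by
      obtain ⟨n, hn⟩ := hc u hu
      exact ⟨n, by simpa using hn⟩)
  obtain ⟨u, hu, hq⟩ := (h b.toNat).1 hv
  exact hb u hu hq

variable (A)

/-- Starting with credit `b`, the protagonist can stay in `O` forever
while the credit, from which the cost of every visited vertex is deducted, stays nonnegative. -/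
def Safe (O : Set V) (v : V) (b : ℤ) : Prop :=
  ∃ R : V → ℤ → Prop, (∀ v b, R v b → v ∈ O ∧ 0 ≤ b ∧ A.Ctrl (fun u => R u (b - A.cost v)) v) ∧
    R v b

/-- Some initial credit suffices. -/
def Good (O : Set V) (v : V) : Prop := ∃ b, A.Safe O v b

variable {A} {O : Set V} {v : V} {b b' : ℤ}

lemma Safe.unfold (h : A.Safe O v b) :
    v ∈ O ∧ 0 ≤ b ∧ A.Ctrl (fun u => A.Safe O u (b - A.cost v)) v := by
  obtain ⟨R, hR, h⟩ := h
  obtain ⟨h1, h2, h3⟩ := hR v b h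
  exact ⟨h1, h2, h3.mono fun u _ hu => ⟨R, hR, hu⟩⟩

lemma Safe.mono (h : A.Safe O v b) (hb : b ≤ b') : A.Safe O v b' := by
  refine ⟨fun v b' => ∃ b ≤ b', A.Safe O v b, ?_, b, hb, h⟩
  rintro v b' ⟨b, hb, h⟩
  obtain ⟨h1, h2, h3⟩ := h.unfold
  exact ⟨h1, h2.trans hb, h3.mono fun u _ hu => ⟨_, by omega, hu⟩⟩

lemma good_of_ctrl (hv : v ∈ O) (h : A.Ctrl (A.Good O) v) : A.Good O v := by
  obtain ⟨K, hK⟩ := exists_uniform_bound (A.finite_step v)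
    (P := fun u b => A.Good O u → A.Safe O u b)
    (fun u b b' hbb hs hg => (hs hg).mono hbb)
    (fun u _ => by
      by_cases hg : A.Good O u
      · exact ⟨hg.choose, fun _ => hg.choose_spec⟩
      · exact ⟨0, fun h => absurd h hg⟩)
  refine ⟨max 0 (K + A.cost v), fun u b => A.Safe O u b ∨ (u = v ∧ max 0 (K + A.cost v) ≤ b), ?_,
    Or.inr ⟨rfl, le_rfl⟩⟩
  rintro u b (hs | ⟨rfl, hb⟩)
  · obtain ⟨h1, h2, h3⟩ := hs.unfold
    exact ⟨h1, h2, h3.mono fun _ _ h => Or.inl h⟩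
  · refine ⟨hv, by omega, h.mono fun u' hu hg => Or.inl ((hK u' hu hg).mono (by omega))⟩

/-- A relation that is closed up to `Good` vertices and that only uses bounded credits
contains `Good` vertices only. -/
lemma good_of_closed (hfin : ∀ C, {v | v ∈ O ∧ A.cost v ≤ C}.Finite) (C : ℤ)
    (R : V → ℤ → Prop)
    (hR : ∀ v b, R v b → v ∈ O ∧ 0 ≤ b ∧ b ≤ C ∧
      A.Ctrl (fun u => A.Good O u ∨ ∃ b' ≤ b - A.cost v, R u b') v)
    (h : R v b) : A.Good O v := by
  by_contra hbad
  obtain ⟨K, hK⟩ := exists_uniform_bound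
    (((hfin C).biUnion fun v _ => A.finite_step v))
    (P := fun u b => A.Good O u → A.Safe O u b)
    (fun u b b' hbb hs hg => (hs hg).mono hbb)
    (fun u _ => by
      by_cases hg : A.Good O u
      · exact ⟨hg.choose, fun _ => hg.choose_spec⟩
      · exact ⟨0, fun h => absurd h hg⟩)
  have hcost : ∀ v b, R v b → ¬ A.Good O v → A.cost v ≤ b := by
    intro v b hr hg
    by_contra! hlt
    refine hg (good_of_ctrl (hR v b hr).1 ((hR v b hr).2.2.2.mono ?_))
    rintro u - (hu | ⟨b', hb', hu⟩)
    · exact hu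
    · have := (hR u b' hu).2.1
      omega
  refine hbad ⟨b + max 0 K, fun v b => A.Safe O v b ∨ ∃ b₀, R v b₀ ∧ ¬ A.Good O v ∧
    b₀ + max 0 K ≤ b, ?_, Or.inr ⟨b, h, hbad, le_rfl⟩⟩
  rintro v b (hs | ⟨b₀, hr, hg, hb⟩)
  · obtain ⟨h1, h2, h3⟩ := hs.unfold
    exact ⟨h1, h2, h3.mono fun _ _ h => Or.inl h⟩
  · obtain ⟨h1, h2, h3, h4⟩ := hR v b₀ hr
    have hc := hcost v b₀ hr hg
    refine ⟨h1, by omega, h4.mono ?_⟩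
    intro u hu h
    by_cases hgu : A.Good O u
    · refine Or.inl ((hK u ?_ hgu).mono (by omega))
      exact Set.mem_biUnion (show v ∈ {v | v ∈ O ∧ A.cost v ≤ C} from ⟨h1, by omega⟩) hu
    · obtain ⟨b', hb', hu'⟩ := h.resolve_left hgu
      exact Or.inr ⟨b', hu', hgu, by omega⟩

variable (A)

/-- The protagonist can survive `n` rounds of the credit game, where reaching a `Good` vertex
counts as a success. -/
def Hold (O : Set V) : ℕ → V → ℤ → Prop
  | 0, v, b => v ∈ O ∧ 0 ≤ b
  | n + 1, v, b => v ∈ O ∧ 0 ≤ b ∧ A.Ctrl (fun u => A.Good O u ∨ Hold O n u (b - A.cost v)) v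

variable {A}

lemma Hold.base {n : ℕ} (h : A.Hold O n v b) : v ∈ O ∧ 0 ≤ b := by
  cases n with
  | zero => exact h
  | succ n => exact ⟨h.1, h.2.1⟩

lemma Hold.mono {n : ℕ} (h : A.Hold O n v b) (hb : b ≤ b') : A.Hold O n v b' := by
  induction n generalizing v b b' with
  | zero => exact ⟨h.1, h.2.trans hb⟩
  | succ n ih =>
    exact ⟨h.1, h.2.1.trans hb, h.2.2.mono fun u _ hu => hu.imp_right fun h => ih h (by omega)⟩

lemma Hold.pred {n : ℕ} (h : A.Hold O (n + 1) v b) : A.Hold O n v b := by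
  induction n generalizing v b with
  | zero => exact h.base
  | succ n ih => exact ⟨h.1, h.2.1, h.2.2.mono fun u _ hu => hu.imp_right ih⟩

lemma Hold.antitone {m n : ℕ} (hmn : m ≤ n) (h : A.Hold O n v b) : A.Hold O m v b := by
  induction n, hmn using Nat.le_induction with
  | base => exact h
  | succ n _ ih => exact ih h.pred

lemma ctrl_of_forall_hold (h : ∀ n, A.Hold O n v b) :
    A.Ctrl (fun u => A.Good O u ∨ ∀ n, A.Hold O n u (b - A.cost v)) v := by
  refine (ctrl_forall_of_antitone (fun m n hmn u hu => hu.imp_right (Hold.antitone hmn))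
    fun n => (h (n + 1)).2.2).mono fun u _ hu => ?_
  by_cases hg : A.Good O u
  · exact Or.inl hg
  · exact Or.inr fun n => (hu n).resolve_left hg

lemma good_of_forall_hold {M : ℤ} (hM : ∀ v ∈ O, -M ≤ A.cost v)
    (hfin : ∀ C, {v | v ∈ O ∧ A.cost v ≤ C}.Finite) (h : ∀ n, A.Hold O n v b) : A.Good O v := by
  obtain ⟨F, hF⟩ := exists_uniform_bound (hfin 0)
    (P := fun u b => (∃ b', ∀ n, A.Hold O n u b') → ∀ n, A.Hold O n u b)
    (fun u b b' hbb hs hg n => (hs hg n).mono hbb)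
    (fun u _ => by
      by_cases hg : ∃ b', ∀ n, A.Hold O n u b'
      · exact ⟨hg.choose, fun _ => hg.choose_spec⟩
      · exact ⟨0, fun h => absurd h hg⟩)
  refine good_of_closed hfin (max (F + max M 0) b) (fun v b' => (∀ n, A.Hold O n v b') ∧
    b' ≤ max (F + max M 0) b) ?_ ⟨h, le_max_right _ _⟩
  rintro v b' ⟨hv, hb'⟩
  refine ⟨(hv 0).1, (hv 0).2, hb', ?_⟩
  by_cases hlow : A.cost v ≤ 0
  · have hvF := hF v ⟨(hv 0).1, hlow⟩ ⟨b', hv⟩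
    have hmin : ∀ n, A.Hold O n v (min b' F) := by
      rcases min_choice b' F with h | h <;> rw [h] <;> assumption
    have := hM v (hv 0).1
    exact (ctrl_of_forall_hold hmin).mono fun u _ hu => hu.imp_right fun hu =>
      ⟨_, by omega, hu, by omega⟩
  · exact (ctrl_of_forall_hold hv).mono fun u _ hu => hu.imp_right fun hu =>
      ⟨_, le_rfl, hu, by omega⟩

variable (A)

/-- The antagonist's invariant against which every `T` rounds are worth a unit of cost;
`p` is a lower bound for the potential. -/
def Punish (O : Set V) (M : ℤ) (T : ℕ) (v : V) (p : ℤ) : Prop :=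
  ¬ A.Good O v ∧ ∃ (n : ℕ) (b : ℤ), ¬ A.Hold O n v b ∧ b + n * M ≤ T * M ∧ p ≤ T * b - n

variable {A}

lemma Punish.le {M : ℤ} (hM : 0 ≤ M) {T : ℕ} {p : ℤ} (h : A.Punish O M T v p) :
    p ≤ T * (T * M) := by
  obtain ⟨-, n, b, -, hb, hp⟩ := h
  have : b ≤ T * M := by nlinarith
  nlinarith [mul_le_mul_of_nonneg_left this (Int.natCast_nonneg T)]

lemma Punish.oppCtrl {M : ℤ} (hM : ∀ v ∈ O, -M ≤ A.cost v) {T : ℕ} (hT : 1 ≤ T)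
    (hhold : ∀ v ∈ O, A.cost v ≤ 0 → ¬ A.Good O v → ¬ A.Hold O T v 0)
    {p : ℤ} (h : A.Punish O M T v p) (hv : v ∈ O) :
    A.OppCtrl (fun u => ∃ p', A.Punish O M T u p' ∧ p ≤ p' + T * A.cost v - 1) v := by
  have hT' : (1 : ℤ) ≤ T := by exact_mod_cast hT
  obtain ⟨hbad, n, b, hn, hb, hp⟩ := h
  have key : ∀ (n : ℕ) (b : ℤ), 0 ≤ b → ¬ A.Hold O n v b → b + n * M ≤ T * M → p ≤ T * b - n →
      A.OppCtrl (fun u => ∃ p', A.Punish O M T u p' ∧ p ≤ p' + T * A.cost v - 1) v := by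
    intro n b hb0 hn hb hp
    cases n with
    | zero => exact absurd ⟨hv, hb0⟩ hn
    | succ m =>
      have hc : ¬ A.Ctrl (fun u => A.Good O u ∨ A.Hold O m u (b - A.cost v)) v :=
        fun hc => hn ⟨hv, hb0, hc⟩
      refine (oppCtrl_of_not_ctrl hc).mono fun u _ hu => ?_
      push Not at hu
      have := hM v hv
      push_cast at hb hp
      refine ⟨T * (b - A.cost v) - m, ⟨hu.1, m, _, hu.2, by linarith, le_rfl⟩, by linarith⟩
  by_cases hb0 : 0 ≤ b
  · exact key n b hb0 hn hb hp
  · by_cases hlow : A.cost v ≤ 0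
    · refine key T 0 le_rfl (hhold v hv hlow hbad) (by linarith) ?_
      nlinarith
    · refine (oppCtrl_of_not_ctrl fun hc => hbad (good_of_ctrl hv hc)).mono fun u _ hu => ?_
      exact ⟨p, ⟨hu, n, b, fun h => hb0 h.base.2, hb, hp⟩, by nlinarith⟩

lemma exists_not_hold {M : ℤ} (hM : ∀ v ∈ O, -M ≤ A.cost v)
    (hfin : ∀ C, {v | v ∈ O ∧ A.cost v ≤ C}.Finite) :
    ∃ T : ℕ, 1 ≤ T ∧ ∀ v ∈ O, A.cost v ≤ 0 → ¬ A.Good O v → ¬ A.Hold O T v 0 := by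
  obtain ⟨F, hF⟩ := exists_uniform_bound (hfin 0)
    (P := fun u b => ¬ A.Good O u → ¬ A.Hold O b.toNat u 0)
    (fun u b b' hbb hs hg hh => hs hg (hh.antitone (Int.toNat_le_toNat hbb)))
    (fun u _ => by
      by_cases hg : A.Good O u
      · exact ⟨0, fun h => absurd hg h⟩
      · obtain ⟨n, hn⟩ := not_forall.1 fun h => hg (good_of_forall_hold hM hfin h)
        exact ⟨n, fun _ => by simpa using hn⟩)
  exact ⟨F.toNat + 1, by omega, fun v hv hc hg hh => hF v ⟨hv, hc⟩ hg hh.pred⟩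

/-- The protagonist can force a visit to `Y` while staying in `O` before. -/
inductive Att (A : Arena V) (O Y : Set V) : V → Prop
  | base {v : V} : v ∈ Y → Att A O Y v
  | own {v u : V} : v ∈ O → v ∈ A.own → A.step v u → Att A O Y u → Att A O Y v
  | opp {v : V} : v ∈ O → v ∉ A.own → (∀ u, A.step v u → Att A O Y u) → Att A O Y v

lemma Att.of_ctrl {Y : Set V} (hv : v ∈ O) (h : A.Ctrl (A.Att O Y) v) : A.Att O Y v := by
  by_cases ho : v ∈ A.own
  · obtain ⟨u, hu, h⟩ := h.1 ho
    exact .own hv ho hu h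
  · exact .opp hv ho (h.2 ho)

lemma Att.mono {O' Y : Set V} (hO : O ⊆ O') (h : A.Att O Y v) : A.Att O' Y v := by
  induction h with
  | base h => exact .base h
  | own hv ho hs _ ih => exact .own (hO hv) ho hs ih
  | opp hv ho _ ih => exact .opp (hO hv) ho ih

lemma Att.trans {O' Y Z : Set V} (hO : O ⊆ O') (hZ : ∀ u ∈ Z, A.Att O' Y u) (h : A.Att O Z v) :
    A.Att O' Y v := by
  induction h with
  | base h => exact hZ _ h
  | own hv ho hs _ ih => exact .own (hO hv) ho hs ih
  | opp hv ho _ ih => exact .opp (hO hv) ho ih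

lemma Att.good {O' Y : Set V} (hO : O' ⊆ O) (hY : ∀ u ∈ Y, A.Good O u) (h : A.Att O' Y v) :
    A.Good O v := by
  induction h with
  | base h => exact hY _ h
  | own hv ho hs _ ih =>
    exact good_of_ctrl (hO hv) ⟨fun _ => ⟨_, hs, ih⟩, fun h => absurd ho h⟩
  | opp hv ho _ ih => exact good_of_ctrl (hO hv) ⟨fun h => absurd h ho, fun _ => ih⟩

end Arena

end AvgEnergy

namespace AvgEnergy

/-- An increasing chain of subsets of a finite set stagnates early. -/
lemma exists_eq_succ_of_subset {X : Type*} {F : Set X} (hF : F.Finite) (s : ℕ → Set X)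
    (mono : ∀ n, s n ⊆ s (n + 1)) (hs : ∀ n, s n ⊆ F) : ∃ j ≤ F.ncard, s j = s (j + 1) := by
  by_contra! hne
  have hcard : ∀ n ≤ F.ncard + 1, n ≤ (s n).ncard := by
    intro n
    induction n with
    | zero => simp
    | succ n ih =>
      intro hn
      have h1 := ih (by omega)
      have h2 := Set.ncard_lt_ncard ((mono n).ssubset_of_ne (hne n (by omega)))
        (hF.subset (hs _))
      omega
  have h1 := hcard _ le_rfl
  have h2 := Set.ncard_le_ncard (hs (F.ncard + 1)) hF
  omega

variable {S : Type*} [Fintype S] (G : Game S) (t₁ t₂ : ℕ)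

lemma Game.finite_E : G.E.Finite := by
  refine (Set.finite_univ.prod ((Set.finite_Icc (-(G.W : ℤ)) G.W).prod Set.finite_univ)).subset ?_
  rintro e he
  exact ⟨trivial, G.wbound e he, trivial⟩

/-- The arena of configurations (state, energy level), where a configuration with energy level `c`
has cost `t₂ c - t₁`. -/
def Game.arena : Arena (S × ℤ) where
  step v u := (v.1, u.2 - v.2, u.1) ∈ G.E
  own := {v | v.1 ∈ G.S0}
  cost v := t₂ * v.2 - t₁
  finite_step v := by
    refine G.finite_E.preimage (f := fun u : S × ℤ => (v.1, u.2 - v.2, u.1)) ?_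
    rintro ⟨u, c⟩ - ⟨u', c'⟩ - h
    simp only [Prod.mk.injEq] at h ⊢
    exact ⟨h.2.2, by omega⟩

/-- The configurations with energy level in `(a, h]`. -/
def band (S : Type*) (a h : ℤ) : Set (S × ℤ) := {v | a < v.2 ∧ v.2 ≤ h}

lemma finite_band (a h : ℤ) : (band S a h).Finite :=
  (Set.finite_univ.prod (Set.finite_Ioc a h)).subset fun _ hv => ⟨trivial, hv⟩

lemma ncard_band (a : ℤ) (n : ℕ) : (band S a (a + n)).ncard = Fintype.card S * n := by
  have : band S a (a + n) = Set.univ ×ˢ (Finset.Ioc a (a + n) : Set ℤ) := by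
    ext v
    simp [band]
  rw [this, Set.ncard_prod, Set.ncard_univ, Nat.card_eq_fintype_card, Set.ncard_coe_finset]
  simp

variable {G t₁ t₂}

lemma Game.step_bounds {v u : S × ℤ} (h : (G.arena t₁ t₂).step v u) :
    v.2 - G.W ≤ u.2 ∧ u.2 ≤ v.2 + G.W := by
  have := G.wbound _ h
  dsimp only at this
  omega

lemma att_shift {a h : ℤ} {Y Y' : Set (S × ℤ)} {v : S × ℤ} (d : ℤ)
    (hY : ∀ u ∈ Y, (u.1, u.2 + d) ∈ Y') (hv : (G.arena t₁ t₂).Att (band S a h) Y v) :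
    (G.arena t₁ t₂).Att (band S (a + d) (h + d)) Y' (v.1, v.2 + d) := by
  induction hv with
  | base hv => exact .base (hY _ hv)
  | @own v u hv ho hs _ ih =>
    refine .own (u := (u.1, u.2 + d)) ?_ ho ?_ ih
    · simp only [band, Set.mem_ofPred_eq] at hv ⊢
      omega
    · simpa [Game.arena] using hs
  | @opp v hv ho _ ih =>
    refine .opp ?_ ho fun u hu => ?_
    · simp only [band, Set.mem_ofPred_eq] at hv ⊢
      omega
    · have := ih (u.1, u.2 - d) ?_
      · simpa using this
      · simp only [Game.arena] at hu ⊢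
        rwa [show u.2 - d - v.2 = u.2 - (v.2 + d) by ring]

lemma att_lower_ceiling {a b h h' : ℤ} {Y : Set (S × ℤ)} (hab : a ≤ b) (hbh : b ≤ h)
    (hY : ∀ u ∈ Y, u.2 ≤ a)
    (hrep : ∀ v ∈ band S b (b + G.W), ∀ Z ⊆ band S (b - G.W) b,
      (G.arena t₁ t₂).Att (band S b h') Z v → (G.arena t₁ t₂).Att (band S b h) Z v)
    {v : S × ℤ} (hv : (G.arena t₁ t₂).Att (band S a h') Y v) (hvb : v.2 ≤ b) :
    (G.arena t₁ t₂).Att (band S a h) Y v := by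
  set Z : Set (S × ℤ) := {u | u ∈ band S (b - G.W) b ∧ (G.arena t₁ t₂).Att (band S a h) Y u}
    with hZ
  suffices hmain : (v.2 ≤ b → (G.arena t₁ t₂).Att (band S a h) Y v) ∧
      (b < v.2 → (G.arena t₁ t₂).Att (band S b h') Z v) from hmain.1 hvb
  clear hvb
  have low : ∀ {v u : S × ℤ}, v.2 ≤ b → (G.arena t₁ t₂).step v u →
      ((u.2 ≤ b → (G.arena t₁ t₂).Att (band S a h) Y u) ∧
        (b < u.2 → (G.arena t₁ t₂).Att (band S b h') Z u)) →
      (G.arena t₁ t₂).Att (band S a h) Y u := by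
    intro v u hv hs hu
    rcases le_or_gt u.2 b with hub | hub
    · exact hu.1 hub
    · have hb := Game.step_bounds hs
      have := hrep u ⟨hub, by omega⟩ Z (fun _ h => h.1) (hu.2 hub)
      exact this.trans (fun w hw => ⟨by have := hw.1; omega, hw.2⟩) (fun w hw => hw.2)
  have high : ∀ {v u : S × ℤ}, b < v.2 → (G.arena t₁ t₂).step v u →
      ((u.2 ≤ b → (G.arena t₁ t₂).Att (band S a h) Y u) ∧
        (b < u.2 → (G.arena t₁ t₂).Att (band S b h') Z u)) →
      (G.arena t₁ t₂).Att (band S b h') Z u := by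
    intro v u hv hs hu
    rcases le_or_gt u.2 b with hub | hub
    · have hb := Game.step_bounds hs
      exact .base ⟨⟨by omega, hub⟩, hu.1 hub⟩
    · exact hu.2 hub
  induction hv with
  | base hv => exact ⟨fun _ => .base hv, fun hb => by have := hY _ hv; omega⟩
  | own hv ho hs _ ih =>
    exact ⟨fun hb => .own ⟨hv.1, hb.trans hbh⟩ ho hs (low hb hs ih),
      fun hb => .own ⟨hb, hv.2⟩ ho hs (high hb hs ih)⟩
  | opp hv ho _ ih =>
    exact ⟨fun hb => .opp ⟨hv.1, hb.trans hbh⟩ ho fun u hs => low hb hs (ih u hs),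
      fun hb => .opp ⟨hb, hv.2⟩ ho fun u hs => high hb hs (ih u hs)⟩

lemma exists_att_band {a : ℤ} {Y : Set (S × ℤ)} {v : S × ℤ}
    (hv : (G.arena t₁ t₂).Att {u | a < u.2} Y v) :
    ∃ h, (G.arena t₁ t₂).Att (band S a h) Y v := by
  have mono : ∀ (u : S × ℤ) (h h' : ℤ), h ≤ h' → (G.arena t₁ t₂).Att (band S a h) Y u →
      (G.arena t₁ t₂).Att (band S a h') Y u :=
    fun u h h' hh => Arena.Att.mono fun w hw => ⟨hw.1, hw.2.trans hh⟩
  induction hv with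
  | base hv => exact ⟨0, .base hv⟩
  | @own v u hv ho hs _ ih =>
    obtain ⟨h, hh⟩ := ih
    exact ⟨max h v.2, .own ⟨hv, le_max_right _ _⟩ ho hs (mono _ _ _ (le_max_left _ _) hh)⟩
  | @opp v hv ho _ ih =>
    obtain ⟨h, hh⟩ := Arena.exists_uniform_bound ((G.arena t₁ t₂).finite_step v) mono ih
    exact ⟨max h v.2, .opp ⟨hv, le_max_right _ _⟩ ho
      fun u hu => mono _ _ _ (le_max_left _ _) (hh u hu)⟩

/-- If a visit to a set of energy levels at most `a` can be forced, then this can be done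
exceeding the initial energy level by a single exponential only. -/
lemma att_band_of_att (G : Game S) (t₁ t₂ : ℕ) {a c : ℤ} {Y : Set (S × ℤ)} {v : S × ℤ}
    (hac : a ≤ c) (hY : ∀ u ∈ Y, u.2 ≤ a) (hvc : v.2 ≤ c)
    (hv : (G.arena t₁ t₂).Att {u | a < u.2} Y v) :
    (G.arena t₁ t₂).Att
      (band S a (c + (Fintype.card S * G.W * 2 ^ (Fintype.card S * G.W) : ℕ))) Y v := by
  have hW1 : (band S 0 G.W).ncard = Fintype.card S * G.W := by
    simpa using ncard_band (S := S) 0 G.W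
  have hW2 : (band S (-G.W) 0).ncard = Fintype.card S * G.W := by
    simpa using ncard_band (S := S) (-G.W) G.W
  obtain ⟨j, hj, hstable⟩ := exists_eq_succ_of_subset
    ((finite_band (S := S) 0 G.W).prod (finite_band (S := S) (-G.W) 0).powerset)
    (fun j : ℕ => {p | p.1 ∈ band S 0 G.W ∧ p.2 ⊆ band S (-G.W) 0 ∧
      (G.arena t₁ t₂).Att (band S 0 j) p.2 p.1})
    (fun n p hp => ⟨hp.1, hp.2.1, hp.2.2.mono fun u hu => ⟨hu.1, by
      have := hu.2; push_cast; omega⟩⟩)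
    (fun n p hp => ⟨hp.1, hp.2.1⟩)
  rw [Set.ncard_prod, Set.ncard_powerset _ (finite_band _ _), hW1, hW2] at hj
  obtain ⟨h, hh⟩ := exists_att_band hv
  have hm : ∀ m : ℕ, (G.arena t₁ t₂).Att (band S a (c + j + m)) Y v →
      (G.arena t₁ t₂).Att (band S a (c + j)) Y v := by
    intro m
    induction m with
    | zero => simp
    | succ m ih =>
      intro hv
      refine ih (att_lower_ceiling (b := c + m) (h' := c + j + (m + 1 : ℕ)) (by omega) (by omega)
        hY ?_ hv (by omega))
      intro u hu Z hZ hatt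
      have hshift := att_shift (-(c + m)) (Y' := {w | (w.1, w.2 + (c + m)) ∈ Z})
        (fun w hw => by
          change (w.1, w.2 + -(c + (m : ℤ)) + (c + m)) ∈ Z
          rwa [neg_add_cancel_right]) hatt
      have hmem : ((u.1, u.2 + -(c + (m : ℤ))), {w : S × ℤ | (w.1, w.2 + (c + m)) ∈ Z}) ∈
          {p : (S × ℤ) × Set (S × ℤ) | p.1 ∈ band S 0 G.W ∧ p.2 ⊆ band S (-G.W) 0 ∧
            (G.arena t₁ t₂).Att (band S 0 (j + 1 : ℕ)) p.2 p.1} := by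
        refine ⟨?_, ?_, ?_⟩
        · have := hu.1
          have := hu.2
          simp only [band, Set.mem_ofPred_eq]
          omega
        · intro w hw
          have := hZ hw
          simp only [band, Set.mem_ofPred_eq] at this ⊢
          omega
        · convert hshift using 2 <;> push_cast <;> ring
      rw [← hstable] at hmem
      have := att_shift (c + m) (Y' := Z) (fun w hw => hw) hmem.2.2
      simp only [neg_add_cancel_right, zero_add, Prod.mk.eta] at this
      convert this using 2
      ring
  refine (hm (h - (c + j)).toNat (hh.mono fun u hu => ⟨hu.1, ?_⟩)).mono fun u hu => ⟨hu.1, ?_⟩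
  · have := hu.2
    omega
  · have := hu.2
    omega

end AvgEnergy

namespace AvgEnergy

variable {S : Type*} [Fintype S] {G : Game S} {t₁ t₂ : ℕ}

lemma cost_nonpos_iff (ht : 1 ≤ t₂) (v : S × ℤ) :
    (G.arena t₁ t₂).cost v ≤ 0 ↔ v.2 ≤ (t₁ / t₂ : ℕ) := by
  have : (0 : ℤ) < t₂ := by exact_mod_cast ht
  simp only [Game.arena]
  rw [Int.natCast_div, Int.le_ediv_iff_mul_le this, mul_comm]
  omega

lemma finite_cost_le (ht : 1 ≤ t₂) (C : ℤ) :
    {v : S × ℤ | v ∈ {v : S × ℤ | 0 ≤ v.2} ∧ (G.arena t₁ t₂).cost v ≤ C}.Finite := by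
  have ht' : (1 : ℤ) ≤ t₂ := by exact_mod_cast ht
  refine (Set.finite_univ.prod (Set.finite_Icc 0 (C + t₁))).subset fun v hv => ⟨trivial, hv.1, ?_⟩
  have h1 : 0 ≤ v.2 := hv.1
  have h2 : (t₂ : ℤ) * v.2 - t₁ ≤ C := hv.2
  nlinarith

lemma neg_le_cost {v : S × ℤ} (hv : v ∈ {v : S × ℤ | 0 ≤ v.2}) :
    -(t₁ : ℤ) ≤ (G.arena t₁ t₂).cost v := by
  have h1 : 0 ≤ v.2 := hv
  simp only [Game.arena]
  have : (0 : ℤ) ≤ t₂ * v.2 := by positivity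
  omega

/-- From every configuration of positive cost, the protagonist can force a visit to a
configuration of nonpositive cost that does not require more credit. -/
lemma att_of_safe (ht : 1 ≤ t₂) (a : ℕ) {v : S × ℤ} {b : ℤ}
    (hv : (G.arena t₁ t₂).Safe {v | 0 ≤ v.2} v b) (hb : b < a) :
    (G.arena t₁ t₂).Att {u | ((t₁ / t₂ : ℕ) : ℤ) < u.2}
      {u | u.2 ≤ (t₁ / t₂ : ℕ) ∧ ∃ k < a, (G.arena t₁ t₂).Safe {v | 0 ≤ v.2} u k} v := by
  induction a generalizing v b with
  | zero =>
    have := hv.unfold.2.1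
    omega
  | succ a ih =>
    rcases le_or_gt v.2 (t₁ / t₂ : ℕ) with h | h
    · exact .base ⟨h, a, by omega, hv.mono (by omega)⟩
    · have hc : ¬ (G.arena t₁ t₂).cost v ≤ 0 := fun hc => by
        have := (cost_nonpos_iff ht v).1 hc
        omega
      refine .of_ctrl h (hv.unfold.2.2.mono fun u _ hu => ?_)
      refine (ih hu (by omega)).trans (subset_refl _) fun w hw => ?_
      obtain ⟨h1, k, hk, h2⟩ := hw
      exact .base ⟨h1, k, by omega, h2⟩

/-- The number of configurations of nonpositive cost. -/
def lowCount (S : Type*) [Fintype S] (t₁ t₂ : ℕ) : ℕ := Fintype.card S * (t₁ / t₂ + 1)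

/-- The energy level above which an excursion is considered as expensive. -/
def softBound (S : Type*) [Fintype S] (t₁ t₂ : ℕ) : ℕ := (lowCount S t₁ t₂ + 2) * (t₁ / t₂ + 1)

/-- An upper bound for the energy level that suffices for winning. -/
def hardBound (G : Game S) (t₁ t₂ : ℕ) : ℕ :=
  softBound S t₁ t₂ + G.W + Fintype.card S * G.W * 2 ^ (Fintype.card S * G.W)

lemma exists_credit_gap (ht : 1 ≤ t₂) (G : Game S) (a : ℕ) : ∃ θ : ℤ, a ≤ θ ∧
    θ ≤ a + lowCount S t₁ t₂ * t₁ ∧ ∀ v, (G.arena t₁ t₂).cost v ≤ 0 →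
      (G.arena t₁ t₂).Safe {v | 0 ≤ v.2} v (θ + t₁) →
      (G.arena t₁ t₂).Safe {v | 0 ≤ v.2} v θ := by
  have hcard : (band S (-1) (t₁ / t₂ : ℕ)).ncard = lowCount S t₁ t₂ := by
    rw [lowCount, ← ncard_band (-1)]
    congr 2
    push_cast
    ring
  obtain ⟨j, hj, heq⟩ := exists_eq_succ_of_subset (finite_band (S := S) (-1) (t₁ / t₂ : ℕ))
    (fun j : ℕ => {v | (G.arena t₁ t₂).cost v ≤ 0 ∧
      (G.arena t₁ t₂).Safe {v | 0 ≤ v.2} v (a + j * t₁)})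
    (fun n v hv => ⟨hv.1, hv.2.mono (by push_cast; nlinarith)⟩)
    (fun n v hv => by
      have h1 : 0 ≤ v.2 := hv.2.unfold.1
      exact ⟨by omega, (cost_nonpos_iff ht v).1 hv.1⟩)
  rw [hcard] at hj
  refine ⟨a + j * t₁, by nlinarith, by gcongr, fun v hc hv => ?_⟩
  have hmem : v ∈ {v | (G.arena t₁ t₂).cost v ≤ 0 ∧
      (G.arena t₁ t₂).Safe {v | 0 ≤ v.2} v (a + (j + 1 : ℕ) * t₁)} := by
    refine ⟨hc, ?_⟩
    convert hv using 1
    push_cast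
    ring
  rw [← heq] at hmem
  exact hmem.2

lemma good_hardBound_of_safe (ht : 1 ≤ t₂) (a : ℕ) {v : S × ℤ}
    (hc : (G.arena t₁ t₂).cost v ≤ 0) (hv : (G.arena t₁ t₂).Safe {v | 0 ≤ v.2} v a) :
    (G.arena t₁ t₂).Good {v | 0 ≤ v.2 ∧ v.2 ≤ hardBound G t₁ t₂} v := by
  induction a using Nat.strong_induction_on generalizing v with
  | _ a ih =>
  obtain ⟨θ, haθ, hθ, hgap⟩ := exists_credit_gap (t₁ := t₁) ht G a
  have hlow : t₁ / t₂ ≤ softBound S t₁ t₂ :=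
    (Nat.le_succ _).trans (Nat.le_mul_of_pos_left _ (by omega))
  have hhard : softBound S t₁ t₂ ≤ hardBound G t₁ t₂ := by
    rw [hardBound]
    omega
  have hexp : ∀ c : ℤ, softBound S t₁ t₂ < c → θ + t₁ < a + (t₂ * c - t₁) := by
    intro c hc
    have h1 : (t₁ : ℤ) + 1 ≤ t₂ * ((t₁ / t₂ : ℕ) + 1) := by
      exact_mod_cast Nat.lt_mul_div_succ t₁ (by omega)
    have h2 : (t₂ : ℤ) * softBound S t₁ t₂ ≤ t₂ * (c - 1) := by gcongr; omega
    have h3 : ((lowCount S t₁ t₂ : ℤ) + 2) * (t₁ + 1) ≤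
        (lowCount S t₁ t₂ + 2) * (t₂ * ((t₁ / t₂ : ℕ) + 1)) := by gcongr
    have h4 : (softBound S t₁ t₂ : ℤ) = (lowCount S t₁ t₂ + 2) * ((t₁ / t₂ : ℕ) + 1) := by
      simp [softBound]
    have h5 : (1 : ℤ) ≤ t₂ := by exact_mod_cast ht
    rw [h4] at h2
    nlinarith
  have hexit : ∀ u b, (G.arena t₁ t₂).Safe {v | 0 ≤ v.2} u b → b ≤ θ + t₁ →
      (softBound S t₁ t₂ : ℤ) < u.2 → u.2 ≤ softBound S t₁ t₂ + G.W →
      (G.arena t₁ t₂).Good {v | 0 ≤ v.2 ∧ v.2 ≤ hardBound G t₁ t₂} u := by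
    intro u b hu hb hsoft hle
    have hul : ((t₁ / t₂ : ℕ) : ℤ) < u.2 := by omega
    have hatt : (G.arena t₁ t₂).Att {u | ((t₁ / t₂ : ℕ) : ℤ) < u.2}
        {u | u.2 ≤ (t₁ / t₂ : ℕ) ∧ ∃ k < a, (G.arena t₁ t₂).Safe {v | 0 ≤ v.2} u k} u := by
      refine .of_ctrl hul (hu.unfold.2.2.mono fun w _ hw => att_of_safe ht a hw ?_)
      have := hexp u.2 hsoft
      simp only [Game.arena]
      omega
    refine (att_band_of_att G t₁ t₂ (c := softBound S t₁ t₂ + G.W) (by omega)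
      (fun w hw => hw.1) hle hatt).good ?_ ?_
    · intro w hw
      have h1 := hw.1
      have h2 := hw.2
      have h3 := Int.natCast_nonneg (t₁ / t₂)
      refine ⟨by omega, ?_⟩
      rw [hardBound]
      push_cast at h2 ⊢
      exact h2
    · rintro w ⟨hw, k, hk, hs⟩
      exact ih k hk ((cost_nonpos_iff ht w).2 hw) hs
  refine Arena.good_of_closed (fun C => (finite_cost_le ht C).subset fun w hw => ⟨hw.1.1, hw.2⟩)
    (θ + t₁) (fun u b => (G.arena t₁ t₂).Safe {v | 0 ≤ v.2} u b ∧ u.2 ≤ softBound S t₁ t₂ ∧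
      b ≤ θ + t₁) ?_ (b := a) ⟨hv, ?_, by omega⟩
  · rintro u b ⟨hu, hsoft, hb⟩
    obtain ⟨hu0, hb0, -⟩ := hu.unfold
    have hu0' : 0 ≤ u.2 := hu0
    refine ⟨⟨hu0, by omega⟩, hb0, hb, ?_⟩
    obtain ⟨b', hb'b, hb', hs⟩ : ∃ b' ≤ b, b' - (G.arena t₁ t₂).cost u ≤ θ + t₁ ∧
        (G.arena t₁ t₂).Safe {v | 0 ≤ v.2} u b' := by
      by_cases hcu : (G.arena t₁ t₂).cost u ≤ 0
      · have := neg_le_cost (G := G) (t₁ := t₁) (t₂ := t₂) hu0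
        refine ⟨min b θ, min_le_left _ _, by omega, ?_⟩
        rcases min_choice b θ with h | h <;> rw [h]
        · exact hu
        · exact hgap u hcu (hu.mono hb)
      · exact ⟨b, le_rfl, by omega, hu⟩
    refine hs.unfold.2.2.mono fun w hw hsw => ?_
    rcases le_or_gt w.2 (softBound S t₁ t₂ : ℤ) with h | h
    · exact Or.inr ⟨_, by omega, hsw, h, hb'⟩
    · have := Game.step_bounds hw
      exact Or.inl (hexit w _ hsw hb' h (by omega))
  · have := (cost_nonpos_iff ht v).1 hc
    omega

end AvgEnergy

namespace AvgEnergy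

section Prefixes

variable {α : Type*}

/-- The energy level at the end of a finite prefix. -/
def energy (ρ : List (WEdge α)) : ℤ := (ρ.map fun e => e.2.1).sum

lemma energy_append_singleton (ρ : List (WEdge α)) (e : WEdge α) :
    energy (ρ ++ [e]) = energy ρ + e.2.1 := by
  simp [energy]

lemma EndSt_append_singleton (s : α) (ρ : List (WEdge α)) (e : WEdge α) :
    EndSt s (ρ ++ [e]) = e.2.2 := by
  simp [EndSt]

/-- The configuration at the end of a finite prefix. -/
def endConf (s : α) (ρ : List (WEdge α)) : α × ℤ := (EndSt s ρ, energy ρ)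

/-- The accumulated cost of the configurations visited before the end of a finite prefix. -/
def prefCost (t₁ t₂ : ℕ) (ρ : List (WEdge α)) : ℤ :=
  ∑ i ∈ Finset.range ρ.length, (t₂ * energy (ρ.take i) - t₁ : ℤ)

lemma prefCost_append_singleton (t₁ t₂ : ℕ) (ρ : List (WEdge α)) (e : WEdge α) :
    prefCost t₁ t₂ (ρ ++ [e]) = prefCost t₁ t₂ ρ + (t₂ * energy ρ - t₁) := by
  rw [prefCost, prefCost, List.length_append, List.length_singleton, Finset.sum_range_succ]
  congr 1
  · refine Finset.sum_congr rfl fun i hi => ?_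
    rw [List.take_append_of_le_length (Finset.mem_range.1 hi).le]
  · rw [List.take_left]

lemma Pref_succ (π : ℕ → WEdge α) (n : ℕ) : Pref π (n + 1) = Pref π n ++ [π n] := by
  rw [Pref, Pref, List.ofFn_succ_last]
  simp

lemma Pref_length (π : ℕ → WEdge α) (n : ℕ) : (Pref π n).length = n := by
  simp [Pref]

lemma energy_Pref (π : ℕ → WEdge α) (n : ℕ) : energy (Pref π n) = EL π n := by
  induction n with
  | zero => simp [energy, Pref, EL]
  | succ n ih => rw [Pref_succ, energy_append_singleton, ih, EL, EL, Finset.sum_range_succ]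

lemma prefCost_Pref (t₁ t₂ : ℕ) (π : ℕ → WEdge α) (n : ℕ) :
    prefCost t₁ t₂ (Pref π n) = ∑ i ∈ Finset.range n, (t₂ * EL π i - t₁ : ℤ) := by
  induction n with
  | zero => simp [prefCost, Pref]
  | succ n ih => rw [Pref_succ, prefCost_append_singleton, ih, energy_Pref, Finset.sum_range_succ]

lemma IsPrefixFrom.append_singleton {E : Set (WEdge α)} {s : α} {ρ : List (WEdge α)} {e : WEdge α}
    (hρ : IsPrefixFrom E s ρ) (he : e ∈ E) (hs : e.1 = EndSt s ρ) :
    IsPrefixFrom E s (ρ ++ [e]) := by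
  obtain ⟨h1, h2, h3⟩ := hρ
  refine ⟨?_, ?_, ?_⟩
  · intro f hf
    rcases List.mem_append.1 hf with h | h
    · exact h1 f h
    · rwa [List.mem_singleton.1 h]
  · refine List.isChain_append.2 ⟨h2, List.isChain_singleton _, ?_⟩
    intro x hx y hy
    obtain rfl : e = y := by simpa using hy
    rw [hs, EndSt, Option.mem_def.1 hx]
    rfl
  · intro f hf
    cases ρ with
    | nil =>
      obtain rfl : e = f := by simpa using hf
      simpa [EndSt] using hs
    | cons g ρ => exact h3 f (by simpa using hf)

lemma EndSt_Pref {E : Set (WEdge α)} {s : α} {π : ℕ → WEdge α} (h : IsPlay E s π) (n : ℕ) :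
    EndSt s (Pref π n) = (π n).1 := by
  cases n with
  | zero => simpa [EndSt, Pref] using h.2.1.symm
  | succ n => rw [Pref_succ, EndSt_append_singleton, h.2.2]

/-- If every prefix satisfying an invariant can be extended by an edge compatible with `σ`, then
there is an outcome of `σ` along which the invariant holds. -/
lemma exists_outcome {E : Set (WEdge α)} {S0 : Set α} {s : α} {σ : List (WEdge α) → WEdge α}
    (Inv : List (WEdge α) → Prop) (h0 : Inv [])
    (hstep : ∀ ρ, IsPrefixFrom E s ρ → Inv ρ →
      ∃ e ∈ E, e.1 = EndSt s ρ ∧ (EndSt s ρ ∈ S0 → e = σ ρ) ∧ Inv (ρ ++ [e])) :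
    ∃ π, IsOutcome E S0 s σ π ∧ ∀ n, Inv (Pref π n) := by
  have : Nonempty (WEdge α) := ⟨(s, 0, s)⟩
  choose! next hE hsrc hσ hInv using hstep
  let f : ℕ → List (WEdge α) := fun n => Nat.rec [] (fun _ ρ => ρ ++ [next ρ]) n
  have hf : ∀ n, IsPrefixFrom E s (f n) ∧ Inv (f n) := by
    intro n
    induction n with
    | zero => exact ⟨⟨by simp [f], List.isChain_nil, by simp [f]⟩, h0⟩
    | succ n ih =>
      exact ⟨ih.1.append_singleton (hE _ ih.1 ih.2) (hsrc _ ih.1 ih.2), hInv _ ih.1 ih.2⟩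
  have hpref : ∀ n, Pref (fun i => next (f i)) n = f n := by
    intro n
    induction n with
    | zero => simp [Pref, f]
    | succ n ih => rw [Pref_succ, ih]
  refine ⟨fun i => next (f i), ⟨⟨fun i => hE _ (hf i).1 (hf i).2, ?_, fun i => ?_⟩, fun n hn => ?_⟩,
    fun n => ?_⟩
  · rw [hsrc _ (hf 0).1 (hf 0).2]
    simp [f, EndSt]
  · rw [hsrc _ (hf (i + 1)).1 (hf (i + 1)).2]
    exact (EndSt_append_singleton s (f i) _).symm
  · rw [hpref] at hn ⊢
    exact hσ _ (hf n).1 (hf n).2 hn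
  · rw [hpref]
    exact (hf n).2

lemma sum_EL_eq (π : ℕ → WEdge α) (t₁ t₂ n : ℕ) :
    ((∑ i ∈ Finset.range (n + 1), (t₂ * EL π i - t₁ : ℤ) : ℤ) : ℚ) =
      t₂ * (n * AE π n) - (n + 1) * t₁ := by
  have h : (n : ℚ) * AE π n = ∑ i ∈ Finset.range n, (EL π (i + 1) : ℚ) := by
    rcases Nat.eq_zero_or_pos n with rfl | hn
    · simp
    · rw [AE, mul_div_cancel₀ _ (by positivity)]
  rw [h, Finset.sum_range_succ']
  push_cast
  rw [Finset.sum_sub_distrib, ← Finset.mul_sum]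
  simp [EL]
  ring

lemma limsupLE_of_sum_le {π : ℕ → WEdge α} {t₁ t₂ : ℕ} (ht : 1 ≤ t₂) {B : ℤ}
    (h : ∀ n, ∑ i ∈ Finset.range n, (t₂ * EL π i - t₁ : ℤ) ≤ B) :
    LimsupLE (AE π) ((t₁ : ℚ) / t₂) := by
  intro ε hε
  have ht' : (1 : ℚ) ≤ t₂ := by exact_mod_cast ht
  obtain ⟨N, hN⟩ := exists_nat_ge (((B : ℚ) + t₁) / ε)
  refine ⟨N + 1, fun n hn => ?_⟩
  have hn' : (N : ℚ) + 1 ≤ n := by exact_mod_cast hn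
  have hn0 : (0 : ℚ) < n := by have := Nat.cast_nonneg (α := ℚ) N; linarith
  have h1 : ((∑ i ∈ Finset.range (n + 1), (t₂ * EL π i - t₁ : ℤ) : ℤ) : ℚ) ≤ B := by
    exact_mod_cast h (n + 1)
  rw [sum_EL_eq] at h1
  have h2 : (B : ℚ) + t₁ ≤ n * ε := by
    rw [div_le_iff₀ hε] at hN
    nlinarith
  have h3 : n * ε ≤ t₂ * (n * ε) := by
    have : 0 ≤ n * ε := by positivity
    nlinarith
  have h4 : (n * t₂ : ℚ) * AE π n ≤ n * t₂ * (t₁ / t₂ + ε) := by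
    have h5 : (n * t₂ : ℚ) * (t₁ / t₂ + ε) = n * t₁ + t₂ * (n * ε) := by
      field_simp
    rw [h5]
    nlinarith
  exact le_of_mul_le_mul_left h4 (by positivity)

lemma not_limsupLE_of_le_sum {π : ℕ → WEdge α} {t₁ t₂ T : ℕ} (ht : 1 ≤ t₂) (hT : 1 ≤ T) {C : ℤ}
    (h : ∀ n : ℕ, (n : ℤ) ≤ C + T * ∑ i ∈ Finset.range n, (t₂ * EL π i - t₁ : ℤ)) :
    ¬ LimsupLE (AE π) ((t₁ : ℚ) / t₂) := by
  intro hlim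
  have ht' : (1 : ℚ) ≤ t₂ := by exact_mod_cast ht
  have hT' : (1 : ℚ) ≤ T := by exact_mod_cast hT
  obtain ⟨N, hN⟩ := hlim (1 / (2 * T * t₂)) (by positivity)
  obtain ⟨m, hm⟩ := exists_nat_gt (2 * (C : ℚ))
  have h1 := hN (max N m) (le_max_left _ _)
  have hm' : (m : ℚ) ≤ (max N m : ℕ) := by exact_mod_cast le_max_right N m
  generalize max N m = n at *
  have h2 : ((n + 1 : ℕ) : ℚ) ≤
      C + T * ((∑ i ∈ Finset.range (n + 1), (t₂ * EL π i - t₁ : ℤ) : ℤ) : ℚ) := by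
    exact_mod_cast h (n + 1)
  rw [sum_EL_eq] at h2
  have h3 : (T * t₂ * n : ℚ) * AE π n ≤ T * t₂ * n * (t₁ / t₂ + 1 / (2 * T * t₂)) := by gcongr
  have h4 : (T * t₂ * n : ℚ) * (t₁ / t₂ + 1 / (2 * T * t₂)) = T * n * t₁ + n / 2 := by
    field_simp
  have h5 : (0 : ℚ) ≤ T * t₁ := by positivity
  rw [h4] at h3
  push_cast at h2
  nlinarith

end Prefixes

variable {S : Type*} [Fintype S] {G : Game S} {t₁ t₂ : ℕ}

lemma step_endConf {s : S} {ρ : List (WEdge S)} {e : WEdge S} (he : e ∈ G.E)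
    (hs : e.1 = EndSt s ρ) : (G.arena t₁ t₂).step (endConf s ρ) (endConf s (ρ ++ [e])) := by
  simp only [Game.arena, endConf, EndSt_append_singleton, energy_append_singleton, ← hs,
    add_sub_cancel_left]
  exact he

lemma exists_edge_of_step {s : S} {ρ : List (WEdge S)} {u : S × ℤ}
    (h : (G.arena t₁ t₂).step (endConf s ρ) u) :
    ∃ e ∈ G.E, e.1 = EndSt s ρ ∧ endConf s (ρ ++ [e]) = u := by
  refine ⟨_, h, rfl, ?_⟩
  simp only [endConf, EndSt_append_singleton, energy_append_singleton]
  exact Prod.ext rfl (by simp)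

lemma exists_strategy_of_good (ht : 1 ≤ t₂) {s : S} {H : ℕ}
    (h : (G.arena t₁ t₂).Good {v | 0 ≤ v.2 ∧ v.2 ≤ H} (s, 0)) :
    ∃ σ, IsStrategy G.E G.S0 s σ ∧ ∀ π, IsOutcome G.E G.S0 s σ π →
      (∀ n, 0 ≤ EL π n ∧ EL π n ≤ H) ∧ LimsupLE (AE π) ((t₁ : ℚ) / t₂) := by
  obtain ⟨b, hb⟩ := h
  set P : List (WEdge S) → Prop := fun ρ =>
    (G.arena t₁ t₂).Safe {v | 0 ≤ v.2 ∧ v.2 ≤ H} (endConf s ρ) (b - prefCost t₁ t₂ ρ) with hP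
  have hcost : ∀ ρ e, b - prefCost t₁ t₂ (ρ ++ [e]) =
      b - prefCost t₁ t₂ ρ - (G.arena t₁ t₂).cost (endConf s ρ) := by
    intro ρ e
    rw [prefCost_append_singleton]
    simp only [Game.arena, endConf]
    ring
  have hex : ∀ ρ, ∃ e, e ∈ G.E ∧ e.1 = EndSt s ρ ∧
      (EndSt s ρ ∈ G.S0 → P ρ → P (ρ ++ [e])) := by
    intro ρ
    by_cases hc : EndSt s ρ ∈ G.S0 ∧ P ρ
    · obtain ⟨u, hu, hsafe⟩ := hc.2.unfold.2.2.1 hc.1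
      obtain ⟨e, he, hs, rfl⟩ := exists_edge_of_step hu
      refine ⟨e, he, hs, fun _ _ => ?_⟩
      rw [hP]
      simp only [hcost]
      exact hsafe
    · obtain ⟨w, s', hw⟩ := G.total (EndSt s ρ)
      exact ⟨_, hw, rfl, fun h1 h2 => absurd ⟨h1, h2⟩ hc⟩
  choose σ hE hsrc hσ using hex
  refine ⟨σ, fun ρ _ _ => ⟨hE ρ, hsrc ρ⟩, fun π hπ => ?_⟩
  have hinv : ∀ n, P (Pref π n) := by
    intro n
    induction n with
    | zero => simpa [hP, Pref, endConf, EndSt, energy, prefCost] using hb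
    | succ n ih =>
      rw [Pref_succ]
      by_cases hn : EndSt s (Pref π n) ∈ G.S0
      · rw [hπ.2 n hn]
        exact hσ _ hn ih
      · have hstep : (G.arena t₁ t₂).step (endConf s (Pref π n)) (endConf s (Pref π n ++ [π n])) :=
          step_endConf (hπ.1.1 n) (EndSt_Pref hπ.1 n).symm
        have := ih.unfold.2.2.2 hn _ hstep
        rw [hP]
        simp only [hcost]
        exact this
  refine ⟨fun n => ?_, limsupLE_of_sum_le ht (B := b) fun n => ?_⟩
  · have := (hinv n).unfold.1
    simpa [endConf, energy_Pref] using this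
  · have := (hinv n).unfold.2.1
    rw [prefCost_Pref] at this
    omega

lemma good_of_strategy (ht : 1 ≤ t₂) {s : S} {σ : List (WEdge S) → WEdge S}
    (hσ : IsStrategy G.E G.S0 s σ)
    (hwin : ∀ π, IsOutcome G.E G.S0 s σ π →
      (∀ n, 1 ≤ n → 0 ≤ EL π n) ∧ LimsupLE (AE π) ((t₁ : ℚ) / t₂)) :
    (G.arena t₁ t₂).Good {v | 0 ≤ v.2} (s, 0) := by
  by_contra hbad
  have hM : ∀ v ∈ {v : S × ℤ | 0 ≤ v.2}, -(t₁ : ℤ) ≤ (G.arena t₁ t₂).cost v :=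
    fun v hv => neg_le_cost hv
  obtain ⟨T, hT, hhold⟩ := Arena.exists_not_hold hM (finite_cost_le ht)
  suffices h : ∃ π, IsOutcome G.E G.S0 s σ π ∧ ∀ n,
      (∀ i ≤ (Pref π n).length, 0 ≤ energy ((Pref π n).take i)) →
      ∃ p, (G.arena t₁ t₂).Punish {v | 0 ≤ v.2} t₁ T (endConf s (Pref π n)) p ∧
        -T ≤ p + T * prefCost t₁ t₂ (Pref π n) - (Pref π n).length by
    obtain ⟨π, hπ, hinv⟩ := h
    obtain ⟨hnonneg, hlim⟩ := hwin π hπ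
    have hnonneg' : ∀ n, 0 ≤ EL π n := by
      intro n
      rcases Nat.eq_zero_or_pos n with rfl | hn
      · simp [EL]
      · exact hnonneg n hn
    refine not_limsupLE_of_le_sum ht hT (C := T + T * (T * t₁)) (fun n => ?_) hlim
    obtain ⟨p, hp, hle⟩ := hinv n fun i hi => by
      rw [Pref_length] at hi
      have : (Pref π n).take i = Pref π i := by
        induction n, hi using Nat.le_induction with
        | base => exact List.take_of_length_le (Pref_length π i).le
        | succ n hin ih =>
          rw [Pref_succ, List.take_append_of_le_length (by rwa [Pref_length]), ih]
      rw [this, energy_Pref]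
      exact hnonneg' i
    have := hp.le (by positivity)
    rw [prefCost_Pref, Pref_length] at hle
    linarith
  refine exists_outcome (fun ρ => (∀ i ≤ ρ.length, 0 ≤ energy (ρ.take i)) →
    ∃ p, (G.arena t₁ t₂).Punish {v | 0 ≤ v.2} t₁ T (endConf s ρ) p ∧
      -T ≤ p + T * prefCost t₁ t₂ ρ - ρ.length) ?_ ?_
  · intro _
    refine ⟨-T, ⟨hbad, T, 0, ?_, by simp, by simp⟩, by simp [prefCost]⟩
    exact hhold (s, 0) (le_refl (0 : ℤ)) (by simp [Game.arena]) hbad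
  · intro ρ hρ hinv
    have hsucc : ∃ e ∈ G.E, e.1 = EndSt s ρ ∧ (EndSt s ρ ∈ G.S0 → e = σ ρ) := by
      by_cases ho : EndSt s ρ ∈ G.S0
      · exact ⟨σ ρ, (hσ ρ hρ ho).1, (hσ ρ hρ ho).2, fun _ => rfl⟩
      · obtain ⟨w, s', hw⟩ := G.total (EndSt s ρ)
        exact ⟨_, hw, rfl, fun h => absurd h ho⟩
    by_cases hnn : ∀ i ≤ ρ.length, 0 ≤ energy (ρ.take i)
    · obtain ⟨p, hp, hle⟩ := hinv hnn
      have h0 : 0 ≤ energy ρ := by simpa using hnn ρ.length le_rfl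
      have hopp := hp.oppCtrl hM hT hhold h0
      obtain ⟨e, he, hs, heσ, p', hp', hle'⟩ : ∃ e ∈ G.E, e.1 = EndSt s ρ ∧
          (EndSt s ρ ∈ G.S0 → e = σ ρ) ∧
          ∃ p', (G.arena t₁ t₂).Punish {v | 0 ≤ v.2} t₁ T (endConf s (ρ ++ [e])) p' ∧
            p ≤ p' + T * (G.arena t₁ t₂).cost (endConf s ρ) - 1 := by
        by_cases ho : EndSt s ρ ∈ G.S0
        · obtain ⟨e, he, hs, heσ⟩ := hsucc
          exact ⟨e, he, hs, heσ, hopp.1 ho _ (step_endConf he hs)⟩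
        · obtain ⟨u, hu, h⟩ := hopp.2 ho
          obtain ⟨e, he, hs, rfl⟩ := exists_edge_of_step hu
          exact ⟨e, he, hs, fun h => absurd h ho, h⟩
      refine ⟨e, he, hs, heσ, fun _ => ⟨p', hp', ?_⟩⟩
      rw [prefCost_append_singleton]
      simp only [Game.arena, endConf] at hle'
      simp only [List.length_append, List.length_singleton]
      push_cast
      linarith
    · obtain ⟨e, he, hs, heσ⟩ := hsucc
      refine ⟨e, he, hs, heσ, fun h => absurd (fun i hi => ?_) hnn⟩
      have := h i (by simp; omega)
      rwa [List.take_append_of_le_length hi] at this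

lemma hardBound_le (G : Game S) (s : S) (ht : 1 ≤ t₂) (t : ℚ) (h : t = (t₁ : ℚ) / t₂) :
    (hardBound G t₁ t₂ : ℝ) ≤ (2 : ℝ) ^ (((5 : ℕ) : ℝ) * ((t : ℝ) +
      (G.W : ℝ) * (8 * (t₁ : ℝ) * (t₂ : ℝ) * ((t : ℝ) + 1) ^ 3 *
        (Fintype.card S : ℝ) ^ 2 + 1) +
      (Fintype.card S : ℝ) + (G.E.ncard : ℝ) * (G.W : ℝ) +
      (Fintype.card S : ℝ) * ((⌈t⌉ : ℝ) + 1))) := by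
  have ht0 : (0 : ℝ) ≤ t := by
    rw [h]
    push_cast
    positivity
  have hcard : Fintype.card S ≤ G.E.ncard := by
    rw [← Nat.card_eq_fintype_card, ← Set.ncard_univ]
    refine (Set.ncard_le_ncard (t := Prod.fst '' G.E) ?_ (G.finite_E.image _)).trans
      (Set.ncard_image_le G.finite_E)
    intro s _
    obtain ⟨w, s', hw⟩ := G.total s
    exact ⟨_, hw, rfl⟩
  have hpos : 1 ≤ Fintype.card S := Fintype.card_pos_iff.2 ⟨s⟩
  have hceil : ((t₁ / t₂ : ℕ) : ℝ) ≤ ⌈t⌉ := by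
    have h1 : ((t₁ / t₂ : ℕ) : ℚ) ≤ t := h ▸ Nat.cast_div_le
    have h2 : ((t₁ / t₂ : ℕ) : ℚ) ≤ ⌈t⌉ := h1.trans (Int.le_ceil t)
    generalize t₁ / t₂ = q at h2 ⊢
    have h3 : (q : ℤ) ≤ ⌈t⌉ := by exact_mod_cast h2
    exact_mod_cast h3
  set m := lowCount S t₁ t₂ with hm
  set N := Fintype.card S * G.W with hN
  have hq : t₁ / t₂ + 1 ≤ m := by
    rw [hm, lowCount]
    exact Nat.le_mul_of_pos_left _ hpos
  have hbound : hardBound G t₁ t₂ ≤ 2 ^ (5 * (G.W + N + m)) := by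
    have hX : 1 ≤ G.W + N + m := by
      have := (Nat.le_add_left 1 _).trans hq
      omega
    generalize hXe : G.W + N + m = X at hX ⊢
    have h2X : X < 2 ^ X := Nat.lt_two_pow_self
    have h2 : 2 ≤ 2 ^ X := by
      calc 2 = 2 ^ 1 := rfl
        _ ≤ 2 ^ X := Nat.pow_le_pow_right (by norm_num) hX
    have h3 : 2 ^ N ≤ 2 ^ X := Nat.pow_le_pow_right (by norm_num) (by omega)
    have h4 : softBound S t₁ t₂ ≤ (2 ^ X + 2) * 2 ^ X := by
      rw [softBound]
      exact Nat.mul_le_mul (by omega) (by omega)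
    have h5 : N * 2 ^ N ≤ 2 ^ X * 2 ^ X := Nat.mul_le_mul (by omega) h3
    rw [mul_comm 5, pow_mul]
    generalize 2 ^ X = y at *
    have h6 : hardBound G t₁ t₂ ≤ 8 * y ^ 2 := by
      rw [hardBound, ← hN]
      nlinarith
    have h7 : 8 * y ^ 2 ≤ y ^ 5 := by
      calc 8 * y ^ 2 = 2 ^ 3 * y ^ 2 := by norm_num
        _ ≤ y ^ 3 * y ^ 2 := by gcongr
        _ = y ^ 5 := by ring
    exact h6.trans h7
  calc (hardBound G t₁ t₂ : ℝ) ≤ ((2 ^ (5 * (G.W + N + m)) : ℕ) : ℝ) := by exact_mod_cast hbound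
    _ = (2 : ℝ) ^ (((5 * (G.W + N + m) : ℕ)) : ℝ) := by
      rw [Real.rpow_natCast]
      push_cast
      rfl
    _ ≤ _ := by
      refine Real.rpow_le_rpow_of_exponent_le (by norm_num) ?_
      rw [Nat.cast_mul]
      refine mul_le_mul_of_nonneg_left ?_ (by norm_num)
      have e1 : (N : ℝ) ≤ G.E.ncard * G.W := by
        rw [hN]
        exact_mod_cast Nat.mul_le_mul_right _ hcard
      have e2 : (m : ℝ) ≤ Fintype.card S * ((⌈t⌉ : ℝ) + 1) := by
        rw [hm, lowCount]
        push_cast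
        gcongr
      have e3 : (0 : ℝ) ≤ G.W * (8 * (t₁ : ℝ) * (t₂ : ℝ) * ((t : ℝ) + 1) ^ 3 *
        (Fintype.card S : ℝ) ^ 2) := by positivity
      push_cast
      nlinarith

/-- There is an absolute constant `k` such that: for every finite
weighted game `G` with maximal absolute weight `W`, initial state `s_init`, and
threshold `t = t₁/t₂`, setting
`U = 2^{k·(t + W·(8 t₁ t₂ (t+1)³ |S|² + 1) + |S| + |E|·W + |S|·(⌈t⌉+1))}`,
`P₀` has a winning strategy in `G` from `s_init` for `AEL(t) = EGL ∩ AE(t)` if, and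
only if, `P₀` has a winning strategy in `G` from `s_init` for
`AELU(t, U) = EGLU(U) ∩ AE(t)`. -/
theorem statement11 :
    ∃ k : ℕ, ∀ (S : Type) [Fintype S], ∀ (G : Game S) (sinit : S)
      (t₁ t₂ : ℕ), 1 ≤ t₂ → ∀ t : ℚ, t = (t₁ : ℚ) / (t₂ : ℚ) →
      ((∃ σ, IsStrategy G.E G.S0 sinit σ ∧
          ∀ π, IsOutcome G.E G.S0 sinit σ π →
            (∀ n, 1 ≤ n → 0 ≤ EL π n) ∧ LimsupLE (AE π) t) ↔
       (∃ σ, IsStrategy G.E G.S0 sinit σ ∧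
          ∀ π, IsOutcome G.E G.S0 sinit σ π →
            (∀ n, 1 ≤ n → 0 ≤ EL π n ∧
              (EL π n : ℝ) ≤ (2 : ℝ) ^ ((k : ℝ) * ((t : ℝ) +
                (G.W : ℝ) * (8 * (t₁ : ℝ) * (t₂ : ℝ) * ((t : ℝ) + 1) ^ 3 *
                  (Fintype.card S : ℝ) ^ 2 + 1) +
                (Fintype.card S : ℝ) + (G.E.ncard : ℝ) * (G.W : ℝ) +
                (Fintype.card S : ℝ) * ((⌈t⌉ : ℝ) + 1)))) ∧
            LimsupLE (AE π) t)) := by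
  refine ⟨5, fun S _ G s t₁ t₂ ht t h => ⟨?_, ?_⟩⟩
  · rintro ⟨σ, hσ, hwin⟩
    obtain ⟨b, hb⟩ := good_of_strategy ht hσ (h ▸ hwin)
    have hgood := good_hardBound_of_safe (G := G) (t₁ := t₁) ht b.toNat (v := (s, 0))
      (by simp [Game.arena]) (hb.mono (Int.self_le_toNat b))
    obtain ⟨σ', hσ', hwin'⟩ := exists_strategy_of_good ht hgood
    refine ⟨σ', hσ', fun π hπ => ⟨fun n _ => ⟨((hwin' π hπ).1 n).1, ?_⟩, h ▸ (hwin' π hπ).2⟩⟩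
    refine le_trans ?_ (hardBound_le G s ht t h)
    exact_mod_cast ((hwin' π hπ).1 n).2
  · rintro ⟨σ, hσ, hwin⟩
    exact ⟨σ, hσ, fun π hπ => ⟨fun n hn => ((hwin π hπ).1 n hn).1, (hwin π hπ).2⟩⟩

end AvgEnergy
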